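/- arXiv:2101.10255 — 2 statements merged into one kernel-verified Lean document; each statement's English description precedes it below -/
import Mathlib

section
/- Let n and p be positive integers, let Σ be a symmetric invertible real n×n matrix, and let Ψ be a real n×p matrix such that Ψ'Σ⁻¹Ψ is invertible. Let b : ℕ → ℝⁿ be a sequence of vectors such that for every pair of indices i, j ∈ {1,…,n} the family s ↦ b_s(i)·b_s(j) is summable with Σ_{s∈ℕ} b_s(i) b_s(j) = Σ_{ij}. Define M = Σ⁻¹Ψ(Ψ'Σ⁻¹Ψ)⁻¹Ψ'Σ⁻¹ and v(s,t) = b_s'·M·b_t for s, t ∈ ℕ. Then: (i) v(s,t) = v(t,s) for all s, t; (ii) for every s, t the family r ↦ v(s,r)·v(r,t) is summable with Σ_{r∈ℕ} v(s,r)·v(r,t) = v(s,t) (idempotency); and (iii) the family s ↦ v(s,s) is summable with Σ_{s∈ℕ} v(s,s) = p. -/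
open Matrix

section SecondMoment

variable {ι κ : Type*} [Fintype ι] {b : κ → ι → ℝ} {S : Matrix ι ι ℝ}

theorem hasSum_dotProduct_mul_dotProduct
    (hb : ∀ i j, HasSum (fun s => b s i * b s j) (S i j)) (x y : ι → ℝ) :
    HasSum (fun r => (x ⬝ᵥ b r) * (b r ⬝ᵥ y)) (x ⬝ᵥ S *ᵥ y) := by
  have h : HasSum (fun r => ∑ i, ∑ j, x i * y j * (b r i * b r j))
      (∑ i, ∑ j, x i * y j * S i j) :=
    hasSum_sum fun i _ => hasSum_sum fun j _ => (hb i j).mul_left _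
  convert h using 1
  · funext r
    simp only [dotProduct, Finset.sum_mul_sum]
    exact Finset.sum_congr rfl fun i _ => Finset.sum_congr rfl fun j _ => by ring
  · simp only [dotProduct, mulVec, Finset.mul_sum]
    exact Finset.sum_congr rfl fun i _ => Finset.sum_congr rfl fun j _ => by ring

theorem hasSum_dotProduct_mulVec_self
    (hb : ∀ i j, HasSum (fun s => b s i * b s j) (S i j)) (A : Matrix ι ι ℝ) :
    HasSum (fun s => b s ⬝ᵥ A *ᵥ b s) (A * S).trace := by
  have h : HasSum (fun s => ∑ i, ∑ j, A i j * (b s j * b s i)) (∑ i, ∑ j, A i j * S j i) :=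
    hasSum_sum fun i _ => hasSum_sum fun j _ => (hb j i).mul_left _
  simp only [trace, diag_apply, mul_apply]
  convert h using 2 with s
  simp only [dotProduct, mulVec, Finset.mul_sum]
  exact Finset.sum_congr rfl fun i _ => Finset.sum_congr rfl fun j _ => by ring

end SecondMoment

/-- **The weighting matrix 𝒱 of the test statistic is symmetric, idempotent, with trace p.**
Here `Σ` is symmetric invertible with `Σ_{ij} = Σ_s b_s(i) b_s(j)`,
`M = Σ⁻¹Ψ(ΨᵀΣ⁻¹Ψ)⁻¹ΨᵀΣ⁻¹`, and `v(s,t) = b_sᵀ M b_t` are the entries of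
`𝒱 = BᵀΣ⁻¹Ψ(ΨᵀΣ⁻¹Ψ)⁻¹ΨᵀΣ⁻¹B`. -/
theorem weighting_matrix_symm_idem_trace
    (n p : ℕ) (hn : 0 < n) (hp : 0 < p)
    (Sig : Matrix (Fin n) (Fin n) ℝ) (hSig_symm : Sigᵀ = Sig) (hSig_unit : IsUnit Sig.det)
    (Ψ : Matrix (Fin n) (Fin p) ℝ) (hΨ : IsUnit (Ψᵀ * Sig⁻¹ * Ψ).det)
    (b : ℕ → Fin n → ℝ)
    (hb : ∀ i j : Fin n, HasSum (fun s : ℕ => b s i * b s j) (Sig i j))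
    (M : Matrix (Fin n) (Fin n) ℝ)
    (hM : M = Sig⁻¹ * Ψ * (Ψᵀ * Sig⁻¹ * Ψ)⁻¹ * Ψᵀ * Sig⁻¹)
    (v : ℕ → ℕ → ℝ) (hv : ∀ s t, v s t = b s ⬝ᵥ M.mulVec (b t)) :
    (∀ s t, v s t = v t s) ∧
    (∀ s t, HasSum (fun r : ℕ => v s r * v r t) (v s t)) ∧
    HasSum (fun s : ℕ => v s s) (p : ℝ) := by
  have hMT : Mᵀ = M := by
    simp [hM, transpose_mul, transpose_nonsing_inv, hSig_symm, Matrix.mul_assoc]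
  have hMS : M * Sig = Sig⁻¹ * Ψ * (Ψᵀ * Sig⁻¹ * Ψ)⁻¹ * Ψᵀ := by
    rw [hM, Matrix.mul_assoc _ Sig⁻¹ Sig, nonsing_inv_mul _ hSig_unit, Matrix.mul_one]
  have hMSM : M * Sig * M = M := by
    calc M * Sig * M
        = Sig⁻¹ * Ψ * ((Ψᵀ * Sig⁻¹ * Ψ)⁻¹ * (Ψᵀ * Sig⁻¹ * Ψ)) * (Ψᵀ * Sig⁻¹ * Ψ)⁻¹ * Ψᵀ
            * Sig⁻¹ := by
          rw [hMS, hM]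
          simp only [Matrix.mul_assoc]
      _ = M := by rw [nonsing_inv_mul _ hΨ, Matrix.mul_one, hM]
  have htrace : (M * Sig).trace = p := by
    rw [hMS, Matrix.trace_mul_comm, ← Matrix.mul_assoc, ← Matrix.mul_assoc,
      mul_nonsing_inv _ hΨ, trace_one, Fintype.card_fin]
  have hvM : ∀ s t, v s t = (M *ᵥ b s) ⬝ᵥ b t := fun s t => by
    rw [hv, dotProduct_mulVec, ← mulVec_transpose, hMT]
  refine ⟨fun s t => ?_, fun s t => ?_, ?_⟩
  · rw [hv, hvM, dotProduct_comm]
  · have h := hasSum_dotProduct_mul_dotProduct hb (M *ᵥ b s) (M *ᵥ b t)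
    have hval : (M *ᵥ b s) ⬝ᵥ Sig *ᵥ (M *ᵥ b t) = v s t := by
      rw [mulVec_mulVec, ← vecMul_transpose, hMT, ← dotProduct_mulVec, mulVec_mulVec,
        ← Matrix.mul_assoc, hMSM, hv]
    rw [hval] at h
    simpa only [← hvM, ← hv] using h
  · rw [← htrace]
    simpa only [hv] using hasSum_dotProduct_mulVec_self hb M
end

section
/- Let n be a positive integer, let Σ be a real n×n matrix, and let b : ℕ → ℝⁿ be a sequence of vectors such that for every pair of indices i, j ∈ {1,…,n} the family s ↦ b_s(i)·b_s(j) is summable with Σ_{s∈ℕ} b_s(i) b_s(j) = Σ_{ij}. Then for every symmetric real n×n matrix M, the doubly-indexed family (s,t) ↦ (b_s'·M·b_t)² is summable over ℕ×ℕ and Σ_{s∈ℕ} Σ_{t∈ℕ} (b_s'·M·b_t)² = trace(M·Σ·M·Σ). -/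
open Matrix

theorem Matrix.sq_dotProduct_mulVec {ι R : Type*} [Fintype ι] [CommSemiring R]
    (M : Matrix ι ι R) (x y : ι → R) :
    (x ⬝ᵥ M.mulVec y) ^ 2 =
      ∑ i, ∑ k, ∑ l, ∑ j, (M i j * M k l) * ((x i * x k) * (y j * y l)) := by
  simp only [dotProduct, mulVec, sq, Finset.sum_mul_sum]
  refine Finset.sum_congr rfl fun i _ => Finset.sum_congr rfl fun k _ => ?_
  rw [mul_mul_mul_comm, mul_comm (∑ j, M i j * y j), Finset.sum_mul_sum, Finset.mul_sum]
  refine Finset.sum_congr rfl fun l _ => ?_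
  rw [Finset.mul_sum]
  exact Finset.sum_congr rfl fun j _ => by ring

theorem Matrix.IsSymm.trace_mul_mul_mul {ι R : Type*} [Fintype ι] [CommSemiring R]
    {M S : Matrix ι ι R} (hM : M.IsSymm) (hS : S.IsSymm) :
    (M * S * M * S).trace = ∑ i, ∑ k, ∑ l, ∑ j, (M i j * M k l) * (S i k * S j l) := by
  simp only [trace, diag_apply, mul_apply, Finset.sum_mul]
  refine Finset.sum_congr rfl fun i _ => Finset.sum_congr rfl fun k _ =>
    Finset.sum_congr rfl fun l _ => Finset.sum_congr rfl fun j _ => ?_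
  rw [hM.apply k l, hS.apply i k]
  ring

/-- **Sum of squares of the entries of `BᵀMB` in closed form.**
If `Σ_{ij} = Σ_s b_s(i) b_s(j)` and `M` is symmetric, then
`Σ_{s,t} (b_sᵀ M b_t)² = trace (M Σ M Σ)`. -/
theorem sum_sq_quadratic_forms_eq_trace
    (n : ℕ) (hn : 0 < n)
    (Sig : Matrix (Fin n) (Fin n) ℝ)
    (b : ℕ → Fin n → ℝ)
    (hb : ∀ i j : Fin n, HasSum (fun s : ℕ => b s i * b s j) (Sig i j))
    (M : Matrix (Fin n) (Fin n) ℝ) (hM_symm : Mᵀ = M) :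
    HasSum (fun st : ℕ × ℕ => (b st.1 ⬝ᵥ M.mulVec (b st.2)) ^ 2)
      (M * Sig * M * Sig).trace := by
  have hSig : Sig.IsSymm := IsSymm.ext fun i j =>
    (hb j i).unique (by simpa only [mul_comm] using hb i j)
  rw [IsSymm.trace_mul_mul_mul hM_symm hSig]
  simp only [sq_dotProduct_mulVec]
  refine hasSum_sum fun i _ => hasSum_sum fun k _ => hasSum_sum fun l _ => hasSum_sum fun j _ => ?_
  exact ((hb i k).mul (hb j l)
    (summable_mul_of_summable_norm (hb i k).summable.norm (hb j l).summable.norm)).mul_left _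
end
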